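/- arXiv:1908.06323 — 8 statements merged into one kernel-verified Lean document; each statement's English description precedes it below -/
import Mathlib

section
/- Let X ⊆ Y be finite subsets of ℝ^n (with the Euclidean metric), let r > 0, suppose X is r-dense in Y, and let s ≥ 0. Then there exists a function θ : Y → X such that θ(x) = x for all x ∈ X, d(y, θ(y)) < r for all y ∈ Y, and: (i) for every simplex σ of V_s(Y), the image θ(σ) is a simplex of V_{s+2r}(X); (ii) for every simplex σ of V_s(Y), the set σ ∪ θ(σ) is a simplex of V_{s+2r}(Y). -/
open scoped Classical

noncomputable section

namespace DataHomotopy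

/-- Points of `ℝ^n` with the Euclidean metric. -/
abbrev Pt (n : ℕ) := EuclideanSpace ℝ (Fin n)

/-- `σ` is a simplex of the Vietoris–Rips complex `V_s(X)`: a nonempty subset of `X`
all of whose pairwise distances are at most `s`. -/
def IsVRSimplex {n : ℕ} (X : Finset (Pt n)) (s : ℝ) (σ : Finset (Pt n)) : Prop :=
  σ.Nonempty ∧ σ ⊆ X ∧ ∀ x ∈ σ, ∀ y ∈ σ, dist x y ≤ s

/-- `x` is a vertex of the Lesnick complex `L_{s,k}(X)`: `x ∈ X` and there are at least
`k` points of `X`, distinct from `x`, within distance `s` of `x`. -/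
def IsLVertex {n : ℕ} (X : Finset (Pt n)) (k : ℕ) (s : ℝ) (x : Pt n) : Prop :=
  x ∈ X ∧ ∃ S : Finset (Pt n), S ⊆ X ∧ x ∉ S ∧ k ≤ S.card ∧ ∀ x' ∈ S, dist x x' ≤ s

/-- `σ` is a simplex of the Lesnick complex `L_{s,k}(X)`: a Vietoris–Rips simplex all of
whose elements are vertices of `L_{s,k}(X)`. -/
def IsLSimplex {n : ℕ} (X : Finset (Pt n)) (k : ℕ) (s : ℝ) (σ : Finset (Pt n)) : Prop :=
  IsVRSimplex X s σ ∧ ∀ x ∈ σ, IsLVertex X k s x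

/-- `x` and `y` lie in the same component of `L_{s,k}(X)`: both are vertices, and they are
joined by a finite chain of vertices with consecutive distances at most `s`. -/
def SameComp {n : ℕ} (X : Finset (Pt n)) (k : ℕ) (s : ℝ) (x y : Pt n) : Prop :=
  IsLVertex X k s x ∧
    Relation.ReflTransGen (fun a b => IsLVertex X k s b ∧ dist a b ≤ s) x y

/-- `p = (s, x)` is an element of `Γ_k(X)`: `s ≥ 0` and `x` is a vertex of `L_{s,k}(X)`. -/
def InGamma {n : ℕ} (X : Finset (Pt n)) (k : ℕ) (p : ℝ × Pt n) : Prop :=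
  0 ≤ p.1 ∧ IsLVertex X k p.1 p.2

/-- The preorder on `Γ_k(X)`: `(s, x) ≼ (t, y)` iff `s ≤ t` and `x`, `y` lie in the same
component of `L_{t,k}(X)`. -/
def GammaLe {n : ℕ} (X : Finset (Pt n)) (k : ℕ) (p q : ℝ × Pt n) : Prop :=
  p.1 ≤ q.1 ∧ SameComp X k q.1 p.2 q.2

/-- `p = (t, x)` is a branch point of `Γ_k(X)`. -/
def IsBranch {n : ℕ} (X : Finset (Pt n)) (k : ℕ) (p : ℝ × Pt n) : Prop :=
  InGamma X k p ∧
    ((∃ s₀, s₀ < p.1 ∧ ∀ s, s₀ ≤ s → s < p.1 →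
        ∃ x₀ x₁ : Pt n, IsLVertex X k s x₀ ∧ IsLVertex X k s x₁ ∧
          ¬ SameComp X k s x₀ x₁ ∧ GammaLe X k (s, x₀) p ∧ GammaLe X k (s, x₁) p) ∨
      ¬ ∃ q : ℝ × Pt n, q.1 < p.1 ∧ InGamma X k q ∧ GammaLe X k q p)

/-- `c` is a least upper bound of `a` and `b` in `Γ_k(X)`. -/
def IsLUBIn {n : ℕ} (X : Finset (Pt n)) (k : ℕ) (a b c : ℝ × Pt n) : Prop :=
  InGamma X k c ∧ GammaLe X k a c ∧ GammaLe X k b c ∧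
    ∀ c', InGamma X k c' → GammaLe X k a c' → GammaLe X k b c' → GammaLe X k c c'

/-- `b` is a maximal branch point below `a` in `Γ_k(X)`. -/
def IsMaxBranchBelow {n : ℕ} (X : Finset (Pt n)) (k : ℕ) (b a : ℝ × Pt n) : Prop :=
  IsBranch X k b ∧ GammaLe X k b a ∧
    ∀ b', IsBranch X k b' → GammaLe X k b' a → GammaLe X k b' b

/-- The Euclidean distance on `(ℝ^n)^m ≅ ℝ^{nm}` between two `m`-tuples. -/
def tupleDist {n m : ℕ} (y x : Fin m → Pt n) : ℝ :=
  Real.sqrt (∑ i, dist (y i) (x i) ^ 2)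

/-- `X^m_dis` is `r`-dense in `Y^m_dis`: every `m`-tuple of pairwise distinct points of `Y`
is within distance `< r` (in `ℝ^{nm}`) of an `m`-tuple of pairwise distinct points of `X`. -/
def ConfigDense {n : ℕ} (X Y : Finset (Pt n)) (m : ℕ) (r : ℝ) : Prop :=
  ∀ y : Fin m → Pt n, (∀ i, y i ∈ Y) → Function.Injective y →
    ∃ x : Fin m → Pt n, (∀ i, x i ∈ X) ∧ Function.Injective x ∧ tupleDist y x < r

/-- `s` and `t` are consecutive phase-change numbers of `Y`: both are realized as distances
between points of `Y`, `s < t`, and no distance between points of `Y` lies strictly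
between `s` and `t`. -/
def IsPhasePair {n : ℕ} (Y : Finset (Pt n)) (s t : ℝ) : Prop :=
  (∃ a ∈ Y, ∃ b ∈ Y, dist a b = s) ∧ (∃ a ∈ Y, ∃ b ∈ Y, dist a b = t) ∧
    s < t ∧ ∀ a ∈ Y, ∀ b ∈ Y, dist a b ≤ s ∨ t ≤ dist a b

/-- `dS X k s x y = u - s`, where `u` is the least number `u ≥ s` such that `x` and `y`
lie in the same component of `L_{u,k}(X)`. -/
def dS {n : ℕ} (X : Finset (Pt n)) (k : ℕ) (s : ℝ) (x y : Pt n) : ℝ :=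
  sInf {u : ℝ | s ≤ u ∧ SameComp X k u x y} - s

/-- A map `Y → X` that moves points by less than `r` sends simplices of `V_s(Y)` to simplices
of `V_{s+2r}(X)`. -/
theorem IsVRSimplex.image_of_dist_lt {n : ℕ} {X Y σ : Finset (Pt n)} {r s : ℝ}
    {θ : Pt n → Pt n} (hσ : IsVRSimplex Y s σ) (hθ : ∀ y ∈ Y, θ y ∈ X ∧ dist y (θ y) < r) :
    IsVRSimplex X (s + 2 * r) (σ.image θ) := by
  obtain ⟨hne, hσY, hdist⟩ := hσ
  refine ⟨hne.image θ, Finset.image_subset_iff.2 fun y hy => (hθ y (hσY hy)).1, ?_⟩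
  simp only [Finset.forall_mem_image]
  intro a ha b hb
  have hab := hdist a ha b hb
  have hra := (hθ a (hσY ha)).2
  have hrb := (hθ b (hσY hb)).2
  have htri := dist_triangle4 (θ a) a b (θ b)
  rw [dist_comm (θ a) a] at htri
  linarith

/-- If a map `Y → X` moves points by less than `r`, then every simplex of `V_s(Y)` spans a
simplex of `V_{s+2r}(Y)` together with its image. -/
theorem IsVRSimplex.union_image_of_dist_lt {n : ℕ} {X Y σ : Finset (Pt n)} {r s : ℝ}
    {θ : Pt n → Pt n} (hσ : IsVRSimplex Y s σ) (hXY : X ⊆ Y) (hr : 0 < r)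
    (hθ : ∀ y ∈ Y, θ y ∈ X ∧ dist y (θ y) < r) :
    IsVRSimplex Y (s + 2 * r) (σ ∪ σ.image θ) := by
  obtain ⟨-, himage, hdist_image⟩ := hσ.image_of_dist_lt hθ
  obtain ⟨hne, hσY, hdist⟩ := hσ
  have hmixed : ∀ a ∈ σ, ∀ b ∈ σ.image θ, dist a b ≤ s + 2 * r := by
    simp only [Finset.forall_mem_image]
    intro a ha b hb
    have hab := hdist a ha b hb
    have hrb := (hθ b (hσY hb)).2
    have htri := dist_triangle a b (θ b)
    linarith
  refine ⟨hne.mono Finset.subset_union_left,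
    Finset.union_subset hσY (himage.trans hXY), fun a ha b hb => ?_⟩
  rcases Finset.mem_union.1 ha with ha | ha <;> rcases Finset.mem_union.1 hb with hb | hb
  · linarith [hdist a ha b hb]
  · exact hmixed a ha b hb
  · exact dist_comm a b ▸ hmixed b hb a ha
  · exact hdist_image a ha b hb

theorem stmt0 {n : ℕ} (X Y : Finset (Pt n)) (hXY : X ⊆ Y) (r : ℝ) (hr : 0 < r)
    (hdense : ∀ y ∈ Y, ∃ x ∈ X, dist y x < r) (s : ℝ) (hs : 0 ≤ s) :
    ∃ θ : Pt n → Pt n,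
      (∀ x ∈ X, θ x = x) ∧
      (∀ y ∈ Y, θ y ∈ X ∧ dist y (θ y) < r) ∧
      (∀ σ : Finset (Pt n), IsVRSimplex Y s σ → IsVRSimplex X (s + 2 * r) (σ.image θ)) ∧
      (∀ σ : Finset (Pt n), IsVRSimplex Y s σ → IsVRSimplex Y (s + 2 * r) (σ ∪ σ.image θ)) := by
  choose! f hfX hfd using hdense
  have hθ : ∀ y ∈ Y, (if y ∈ X then y else f y) ∈ X ∧
      dist y (if y ∈ X then y else f y) < r := by
    intro y hy
    split_ifs with h
    · exact ⟨h, by simpa using hr⟩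
    · exact ⟨hfX y hy, hfd y hy⟩
  refine ⟨fun y => if y ∈ X then y else f y, fun x hx => if_pos hx, hθ, ?_, ?_⟩
  · exact fun σ hσ => hσ.image_of_dist_lt fun y hy => hθ y hy
  · exact fun σ hσ => hσ.union_image_of_dist_lt hXY hr fun y hy => hθ y hy

end DataHomotopy
end
end

section
/- Let X ⊆ Y be finite subsets of ℝ^n, let r > 0, suppose X is r-dense in Y, and let s_i be a phase-change number of Y such that 2r < s_{i+1} − s_i, where s_{i+1} is the next phase-change number of Y. Then V_{s_i+2r}(Y) has the same simplices as V_{s_i}(Y), V_{s_i+2r}(X) has the same simplices as V_{s_i}(X), and there exists θ : Y → X with θ(x) = x for all x ∈ X such that, for every simplex σ of V_{s_i}(Y), θ(σ) is a simplex of V_{s_i}(X) and σ ∪ θ(σ) is a simplex of V_{s_i}(Y). -/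
open scoped Classical

noncomputable section

namespace DataHomotopy

/-- No distance between points of `Y` lies in the gap between consecutive phase-change
numbers. -/
lemma IsPhasePair.dist_le {n : ℕ} {Y : Finset (Pt n)} {s t u : ℝ} (h : IsPhasePair Y s t)
    (hu : u < t) {a b : Pt n} (ha : a ∈ Y) (hb : b ∈ Y) (hab : dist a b ≤ u) :
    dist a b ≤ s :=
  (h.2.2.2 a ha b hb).resolve_right (not_le.mpr (hab.trans_lt hu))

lemma IsPhasePair.isVRSimplex_iff {n : ℕ} {X Y : Finset (Pt n)} {s t u : ℝ}
    (h : IsPhasePair Y s t) (hXY : X ⊆ Y) (hsu : s ≤ u) (hu : u < t) (σ : Finset (Pt n)) :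
    IsVRSimplex X u σ ↔ IsVRSimplex X s σ :=
  ⟨fun ⟨hne, hX, hd⟩ => ⟨hne, hX, fun x hx y hy =>
      h.dist_le hu (hXY (hX hx)) (hXY (hX hy)) (hd x hx y hy)⟩,
    fun ⟨hne, hX, hd⟩ => ⟨hne, hX, fun x hx y hy => (hd x hx y hy).trans hsu⟩⟩

/-- An `r`-dense subset admits a retraction moving every point by less than `r`. -/
lemma exists_retraction_dist_lt {α : Type*} [PseudoMetricSpace α] {X Y : Finset α} {r : ℝ}
    (hr : 0 < r) (hdense : ∀ y ∈ Y, ∃ x ∈ X, dist y x < r) :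
    ∃ θ : α → α, (∀ x ∈ X, θ x = x) ∧ ∀ y ∈ Y, θ y ∈ X ∧ dist y (θ y) < r := by
  have h : ∀ y, ∃ z, (y ∈ X → z = y) ∧ (y ∈ Y → z ∈ X ∧ dist y z < r) := by
    intro y
    by_cases hX : y ∈ X
    · exact ⟨y, fun _ => rfl, fun _ => ⟨hX, by simpa using hr⟩⟩
    · by_cases hY : y ∈ Y
      · obtain ⟨x, hx, hd⟩ := hdense y hY
        exact ⟨x, fun h => absurd h hX, fun _ => ⟨hx, hd⟩⟩
      · exact ⟨y, fun _ => rfl, fun h => absurd h hY⟩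
  choose θ hθX hθY using h
  exact ⟨θ, hθX, hθY⟩

/-- A map moving vertices by at most `r` is contiguous to the identity, up to enlarging
the parameter by `2 * r`. -/
lemma IsVRSimplex.union_image {n : ℕ} {Y σ : Finset (Pt n)} {s r : ℝ} {θ : Pt n → Pt n}
    (hr : 0 ≤ r) (hσ : IsVRSimplex Y s σ) (hθ : ∀ y ∈ Y, θ y ∈ Y ∧ dist y (θ y) ≤ r) :
    IsVRSimplex Y (s + 2 * r) (σ ∪ σ.image θ) := by
  obtain ⟨hne, hY, hd⟩ := hσ
  have hnear : ∀ z ∈ σ ∪ σ.image θ, z ∈ Y ∧ ∃ y ∈ σ, dist y z ≤ r := by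
    intro z hz
    rcases Finset.mem_union.mp hz with hz | hz
    · exact ⟨hY hz, z, hz, by simpa using hr⟩
    · obtain ⟨y, hy, rfl⟩ := Finset.mem_image.mp hz
      exact ⟨(hθ y (hY hy)).1, y, hy, (hθ y (hY hy)).2⟩
  refine ⟨hne.mono Finset.subset_union_left, fun z hz => (hnear z hz).1, fun z hz w hw => ?_⟩
  obtain ⟨-, a, ha, haz⟩ := hnear z hz
  obtain ⟨-, b, hb, hbw⟩ := hnear w hw
  have := dist_triangle4 z a b w
  rw [dist_comm z a] at this
  linarith [hd a ha b hb]

theorem stmt1 {n : ℕ} (X Y : Finset (Pt n)) (hXY : X ⊆ Y) (r : ℝ) (hr : 0 < r)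
    (hdense : ∀ y ∈ Y, ∃ x ∈ X, dist y x < r)
    (si sj : ℝ) (hphase : IsPhasePair Y si sj) (hgap : 2 * r < sj - si) :
    (∀ σ : Finset (Pt n), IsVRSimplex Y (si + 2 * r) σ ↔ IsVRSimplex Y si σ) ∧
    (∀ σ : Finset (Pt n), IsVRSimplex X (si + 2 * r) σ ↔ IsVRSimplex X si σ) ∧
    ∃ θ : Pt n → Pt n,
      (∀ x ∈ X, θ x = x) ∧ (∀ y ∈ Y, θ y ∈ X) ∧
      ∀ σ : Finset (Pt n), IsVRSimplex Y si σ →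
        IsVRSimplex X si (σ.image θ) ∧ IsVRSimplex Y si (σ ∪ σ.image θ) := by
  have hu : si + 2 * r < sj := by linarith
  have hsu : si ≤ si + 2 * r := by linarith
  obtain ⟨θ, hθX, hθY⟩ := exists_retraction_dist_lt hr hdense
  refine ⟨hphase.isVRSimplex_iff subset_rfl hsu hu, hphase.isVRSimplex_iff hXY hsu hu,
    θ, hθX, fun y hy => (hθY y hy).1, fun σ hσ => ?_⟩
  have hunion : IsVRSimplex Y si (σ ∪ σ.image θ) :=
    (hphase.isVRSimplex_iff subset_rfl hsu hu _).mp
      (hσ.union_image hr.le fun y hy => ⟨hXY (hθY y hy).1, (hθY y hy).2.le⟩)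
  refine ⟨⟨hσ.1.image θ, Finset.image_subset_iff.mpr fun y hy => (hθY y (hσ.2.1 hy)).1,
    fun z hz w hw => hunion.2.2 z (Finset.mem_union_right _ hz) w
      (Finset.mem_union_right _ hw)⟩, hunion⟩

end DataHomotopy
end
end

section
/- Let X ⊆ Y be finite subsets of ℝ^n, let r > 0 and k ≥ 0 an integer, suppose X^{k+1}_dis is r-dense in Y^{k+1}_dis, let s ≥ 0, and suppose L_{s,k}(Y) is nonempty. Then there exists a function θ from the vertices of L_{s,k}(Y) to the vertices of L_{s+2r,k}(X) such that θ(x) = x whenever x is a vertex of L_{s,k}(X), d(y, θ(y)) < r for every vertex y of L_{s,k}(Y), and: (i) for every simplex σ of L_{s,k}(Y), θ(σ) is a simplex of L_{s+2r,k}(X); (ii) for every simplex σ of L_{s,k}(Y), σ ∪ θ(σ) is a simplex of L_{s+2r,k}(Y). -/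
open scoped Classical

noncomputable section

namespace DataHomotopy

theorem IsLVertex.mono {n : ℕ} {X Y : Finset (Pt n)} (hXY : X ⊆ Y) {k : ℕ} {s t : ℝ}
    (hst : s ≤ t) {x : Pt n} (h : IsLVertex X k s x) : IsLVertex Y k t x := by
  obtain ⟨hx, S, hSX, hxS, hcard, hS⟩ := h
  exact ⟨hXY hx, S, hSX.trans hXY, hxS, hcard, fun z hz => (hS z hz).trans hst⟩

theorem dist_le_tupleDist {n m : ℕ} (y x : Fin m → Pt n) (i : Fin m) :
    dist (y i) (x i) ≤ tupleDist y x :=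
  Real.le_sqrt_of_sq_le <| Finset.single_le_sum (f := fun j => dist (y j) (x j) ^ 2)
    (fun _ _ => sq_nonneg _) (Finset.mem_univ i)

theorem dist_le_add_two_mul {α : Type*} [PseudoMetricSpace α] {a b a' b' : α} {r s : ℝ}
    (ha : dist a a' < r) (hb : dist b b' < r) (hab : dist a b ≤ s) :
    dist a' b' ≤ s + 2 * r := by
  have h := dist_triangle4 a' a b b'
  rw [dist_comm a' a] at h
  linarith

theorem IsLVertex.exists_tuple {n : ℕ} {Y : Finset (Pt n)} {k : ℕ} {s : ℝ} {y : Pt n}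
    (h : IsLVertex Y k s y) :
    ∃ v : Fin (k + 1) → Pt n, v 0 = y ∧ (∀ i, v i ∈ Y) ∧ Function.Injective v ∧
      ∀ i, i ≠ 0 → dist y (v i) ≤ s := by
  obtain ⟨hy, S, hSY, hyS, hcard, hS⟩ := h
  obtain ⟨T, hTS, hT⟩ := Finset.exists_subset_card_eq hcard
  let e := T.equivFinOfCardEq hT
  refine ⟨Fin.cons y fun i => (e.symm i : Pt n), rfl, ?_, ?_, ?_⟩
  · exact Fin.cases hy fun i => hSY (hTS (e.symm i).2)
  · rw [Fin.cons_injective_iff]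
    refine ⟨?_, Subtype.val_injective.comp e.symm.injective⟩
    rintro ⟨i, hi⟩
    exact hyS (hi ▸ hTS (e.symm i).2)
  · exact Fin.cases (fun h => absurd rfl h) fun i _ => hS _ (hTS (e.symm i).2)

theorem ConfigDense.exists_isLVertex_near {n : ℕ} {X Y : Finset (Pt n)} {k : ℕ} {r s : ℝ}
    (hdense : ConfigDense X Y (k + 1) r) {y : Pt n} (hy : IsLVertex Y k s y) :
    ∃ x : Pt n, IsLVertex X k (s + 2 * r) x ∧ dist y x < r := by
  obtain ⟨v, rfl, hvY, hvinj, hv⟩ := hy.exists_tuple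
  obtain ⟨x, hxX, hxinj, hx⟩ := hdense v hvY hvinj
  have hclose i : dist (v i) (x i) < r := (dist_le_tupleDist v x i).trans_lt hx
  refine ⟨x 0, ⟨hxX 0, (Finset.univ.erase 0).image x, ?_, ?_, ?_, ?_⟩, hclose 0⟩
  · exact Finset.image_subset_iff.2 fun i _ => hxX i
  · simp [hxinj.eq_iff]
  · simp [Finset.card_image_of_injective _ hxinj]
  · simp only [Finset.forall_mem_image, Finset.mem_erase]
    exact fun i hi => dist_le_add_two_mul (hclose 0) (hclose i) (hv i hi.1)

theorem stmt2 {n : ℕ} (X Y : Finset (Pt n)) (hXY : X ⊆ Y) (r : ℝ) (hr : 0 < r)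
    (k : ℕ) (hdense : ConfigDense X Y (k + 1) r) (s : ℝ) (hs : 0 ≤ s)
    (hne : ∃ y : Pt n, IsLVertex Y k s y) :
    ∃ θ : Pt n → Pt n,
      (∀ x : Pt n, IsLVertex X k s x → θ x = x) ∧
      (∀ y : Pt n, IsLVertex Y k s y →
        IsLVertex X k (s + 2 * r) (θ y) ∧ dist y (θ y) < r) ∧
      (∀ σ : Finset (Pt n), IsLSimplex Y k s σ → IsLSimplex X k (s + 2 * r) (σ.image θ)) ∧
      (∀ σ : Finset (Pt n), IsLSimplex Y k s σ →
        IsLSimplex Y k (s + 2 * r) (σ ∪ σ.image θ)) := by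
  have hs_le : s ≤ s + 2 * r := by linarith
  have hex (y : Pt n) : ∃ x, (IsLVertex X k s y → x = y) ∧
      (IsLVertex Y k s y → IsLVertex X k (s + 2 * r) x ∧ dist y x < r) := by
    by_cases hX : IsLVertex X k s y
    · exact ⟨y, fun _ => rfl, fun _ => ⟨hX.mono subset_rfl hs_le, by simpa using hr⟩⟩
    by_cases hY : IsLVertex Y k s y
    · obtain ⟨x, hx⟩ := hdense.exists_isLVertex_near hY
      exact ⟨x, fun h => absurd h hX, fun _ => hx⟩
    · exact ⟨y, fun _ => rfl, fun h => absurd h hY⟩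
  choose θ hfix hθ using hex
  have himage (σ : Finset (Pt n)) (hσ : IsLSimplex Y k s σ) :
      IsLSimplex X k (s + 2 * r) (σ.image θ) := by
    obtain ⟨⟨hσne, -, hdist⟩, hvert⟩ := hσ
    refine ⟨⟨hσne.image θ, ?_, ?_⟩, ?_⟩
    · exact Finset.image_subset_iff.2 fun y hy => (hθ y (hvert y hy)).1.1
    · simp only [Finset.forall_mem_image]
      exact fun y hy z hz => dist_le_add_two_mul (hθ y (hvert y hy)).2
        (hθ z (hvert z hz)).2 (hdist y hy z hz)
    · simp only [Finset.forall_mem_image]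
      exact fun y hy => (hθ y (hvert y hy)).1
  refine ⟨θ, hfix, hθ, himage, fun σ hσ => ?_⟩
  obtain ⟨⟨-, himageX, hdist_image⟩, hvert_image⟩ := himage σ hσ
  obtain ⟨⟨hσne, hσY, hdist⟩, hvert⟩ := hσ
  have hcross (y) (hy : y ∈ σ) (z) (hz : z ∈ σ.image θ) : dist y z ≤ s + 2 * r := by
    obtain ⟨w, hw, rfl⟩ := Finset.mem_image.1 hz
    linarith [dist_triangle y w (θ w), hdist y hy w hw, (hθ w (hvert w hw)).2]
  refine ⟨⟨hσne.mono Finset.subset_union_left,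
    Finset.union_subset hσY (himageX.trans hXY), fun y hy z hz => ?_⟩, fun y hy => ?_⟩
  · rcases Finset.mem_union.1 hy with hy | hy <;> rcases Finset.mem_union.1 hz with hz | hz
    · exact (hdist y hy z hz).trans hs_le
    · exact hcross y hy z hz
    · exact dist_comm y z ▸ hcross z hz y hy
    · exact hdist_image y hy z hz
  · rcases Finset.mem_union.1 hy with hy | hy
    · exact (hvert y hy).mono subset_rfl hs_le
    · exact (hvert_image y hy).mono hXY le_rfl

end DataHomotopy
end
end

section
/- Let X ⊆ Y be finite subsets of ℝ^n, let r > 0 and k ≥ 0 an integer, suppose X^{k+1}_dis is r-dense in Y^{k+1}_dis, and let s_i be a phase-change number of Y with 2r < s_{i+1} − s_i, where s_{i+1} is the next phase-change number of Y; suppose also that L_{s_i,k}(Y) is nonempty. Then L_{s_i+2r,k}(Y) has the same simplices as L_{s_i,k}(Y), L_{s_i+2r,k}(X) has the same simplices as L_{s_i,k}(X), and there exists a function θ from the vertices of L_{s_i,k}(Y) to the vertices of L_{s_i,k}(X), fixing every vertex of L_{s_i,k}(X), such that for every simplex σ of L_{s_i,k}(Y), θ(σ) is a simplex of L_{s_i,k}(X)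 and σ ∪ θ(σ) is a simplex of L_{s_i,k}(Y). -/
open scoped Classical

noncomputable section

namespace DataHomotopy

/-- If no distance between points of `X` lies in `(s, t]`, the Lesnick complexes
of `X` at `s` and `t` have the same simplices. -/
theorem isLSimplex_iff_of_gap {n : ℕ} {X : Finset (Pt n)} {s t : ℝ} (hst : s ≤ t)
    (hgap : ∀ a ∈ X, ∀ b ∈ X, dist a b ≤ t → dist a b ≤ s) (k : ℕ) (σ : Finset (Pt n)) :
    IsLSimplex X k t σ ↔ IsLSimplex X k s σ := by
  constructor
  · rintro ⟨⟨hne, hσ, hd⟩, hv⟩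
    refine ⟨⟨hne, hσ, fun x hx y hy => hgap x (hσ hx) y (hσ hy) (hd x hx y hy)⟩, fun x hx => ?_⟩
    obtain ⟨hxX, S, hS, hxS, hk, hdS⟩ := hv x hx
    exact ⟨hxX, S, hS, hxS, hk, fun x' hx' => hgap x hxX x' (hS hx') (hdS x' hx')⟩
  · rintro ⟨⟨hne, hσ, hd⟩, hv⟩
    exact ⟨⟨hne, hσ, fun x hx y hy => (hd x hx y hy).trans hst⟩,
      fun x hx => (hv x hx).mono (Finset.Subset.refl X) hst⟩

/-- A vertex of the Lesnick complex of `Y` is `r`-close to a vertex of the Lesnick complex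
of `X`, at a scale larger by `2 * r`. -/
theorem ConfigDense.exists_isLVertex {n : ℕ} {X Y : Finset (Pt n)} {k : ℕ} {r s : ℝ}
    (hdense : ConfigDense X Y (k + 1) r) {y : Pt n} (hy : IsLVertex Y k s y) :
    ∃ x, IsLVertex X k (s + 2 * r) x ∧ dist y x < r := by
  obtain ⟨hyY, S, hS, hyS, hk, hd⟩ := hy
  obtain ⟨T, hTS, hT⟩ := Finset.exists_subset_card_eq hk
  let f : Fin k → Pt n := fun i => (T.equivFinOfCardEq hT).symm i
  have hfT : ∀ i, f i ∈ T := fun i => ((T.equivFinOfCardEq hT).symm i).2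
  have hf : Function.Injective f := Subtype.val_injective.comp (Equiv.injective _)
  obtain ⟨x, hxX, hx, hyx⟩ := hdense (Fin.cons y f)
    (Fin.cases hyY fun i => hS (hTS (hfT i)))
    (Fin.cons_injective_iff.2 ⟨by rintro ⟨i, rfl⟩; exact hyS (hTS (hfT i)), hf⟩)
  have hclose := fun i => (dist_le_tupleDist (Fin.cons y f) x i).trans_lt hyx
  have h0 : dist y (x 0) < r := hclose 0
  refine ⟨x 0, ⟨hxX 0, Finset.univ.image (x ∘ Fin.succ), ?_, ?_, ?_, ?_⟩, h0⟩
  · intro z hz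
    obtain ⟨i, -, rfl⟩ := Finset.mem_image.1 hz
    exact hxX _
  · intro hz
    obtain ⟨i, -, hi⟩ := Finset.mem_image.1 hz
    exact Fin.succ_ne_zero i (hx hi)
  · rw [Finset.card_image_of_injective _ (hx.comp (Fin.succ_injective k))]
    simp
  · intro z hz
    obtain ⟨i, -, rfl⟩ := Finset.mem_image.1 hz
    have hi : dist (f i) (x i.succ) < r := hclose i.succ
    have hyf := hd (f i) (hTS (hfT i))
    have htri := dist_triangle4 (x 0) y (f i) (x i.succ)
    rw [dist_comm (x 0) y] at htri
    rw [Function.comp_apply]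
    linarith

theorem stmt3 {n : ℕ} (X Y : Finset (Pt n)) (hXY : X ⊆ Y) (r : ℝ) (hr : 0 < r)
    (k : ℕ) (hdense : ConfigDense X Y (k + 1) r)
    (si sj : ℝ) (hphase : IsPhasePair Y si sj) (hgap : 2 * r < sj - si)
    (hne : ∃ y : Pt n, IsLVertex Y k si y) :
    (∀ σ : Finset (Pt n), IsLSimplex Y k (si + 2 * r) σ ↔ IsLSimplex Y k si σ) ∧
    (∀ σ : Finset (Pt n), IsLSimplex X k (si + 2 * r) σ ↔ IsLSimplex X k si σ) ∧
    ∃ θ : Pt n → Pt n,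
      (∀ x : Pt n, IsLVertex X k si x → θ x = x) ∧
      (∀ y : Pt n, IsLVertex Y k si y → IsLVertex X k si (θ y)) ∧
      ∀ σ : Finset (Pt n), IsLSimplex Y k si σ →
        IsLSimplex X k si (σ.image θ) ∧ IsLSimplex Y k si (σ ∪ σ.image θ) := by
  have hst : si ≤ si + 2 * r := by linarith
  have hgapY : ∀ a ∈ Y, ∀ b ∈ Y, dist a b ≤ si + 2 * r → dist a b ≤ si := by
    intro a ha b hb hab
    rcases hphase.2.2.2 a ha b hb with h | h
    · exact h
    · linarith
  have hgapX : ∀ a ∈ X, ∀ b ∈ X, dist a b ≤ si + 2 * r → dist a b ≤ si :=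
    fun a ha b hb => hgapY a (hXY ha) b (hXY hb)
  refine ⟨isLSimplex_iff_of_gap hst hgapY k, isLSimplex_iff_of_gap hst hgapX k, ?_⟩
  have hex : ∀ y, ∃ x, (IsLVertex X k si y → x = y) ∧
      (IsLVertex Y k si y → IsLVertex X k si x ∧ dist y x < r) := by
    intro y
    by_cases hyX : IsLVertex X k si y
    · exact ⟨y, fun _ => rfl, fun _ => ⟨hyX, by simpa using hr⟩⟩
    by_cases hyY : IsLVertex Y k si y
    · obtain ⟨x, ⟨hxX, S, hS, hxS, hk, hd⟩, hyx⟩ := hdense.exists_isLVertex hyY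
      exact ⟨x, fun h => absurd h hyX, fun _ =>
        ⟨⟨hxX, S, hS, hxS, hk, fun z hz => hgapX x hxX z (hS hz) (hd z hz)⟩, hyx⟩⟩
    · exact ⟨y, fun _ => rfl, fun h => absurd h hyY⟩
  choose θ hfix hθ using hex
  refine ⟨θ, hfix, fun y hy => (hθ y hy).1, ?_⟩
  rintro σ ⟨⟨hne, hσ, hd⟩, hv⟩
  have hvX : ∀ y ∈ σ, IsLVertex X k si (θ y) := fun y hy => (hθ y (hv y hy)).1
  have hθθ : ∀ y ∈ σ, ∀ z ∈ σ, dist (θ y) (θ z) ≤ si := by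
    intro y hy z hz
    refine hgapX _ (hvX y hy).1 _ (hvX z hz).1 ?_
    have htri := dist_triangle4 (θ y) y z (θ z)
    rw [dist_comm (θ y) y] at htri
    linarith [hd y hy z hz, (hθ y (hv y hy)).2, (hθ z (hv z hz)).2]
  have hidθ : ∀ y ∈ σ, ∀ z ∈ σ, dist y (θ z) ≤ si := by
    intro y hy z hz
    refine hgapY _ (hσ hy) _ (hXY (hvX z hz).1) ?_
    linarith [dist_triangle y z (θ z), hd y hy z hz, (hθ z (hv z hz)).2]
  refine ⟨⟨⟨hne.image θ, Finset.image_subset_iff.2 fun y hy => (hvX y hy).1, ?_⟩, ?_⟩,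
    ⟨⟨hne.mono Finset.subset_union_left, Finset.union_subset hσ
      (Finset.image_subset_iff.2 fun y hy => hXY (hvX y hy).1), ?_⟩, ?_⟩⟩
  · simpa only [Finset.forall_mem_image] using hθθ
  · simpa only [Finset.forall_mem_image] using hvX
  · intro a ha b hb
    rcases Finset.mem_union.1 ha with ha | ha <;> rcases Finset.mem_union.1 hb with hb | hb
    · exact hd a ha b hb
    · obtain ⟨z, hz, rfl⟩ := Finset.mem_image.1 hb
      exact hidθ a ha z hz
    · obtain ⟨y, hy, rfl⟩ := Finset.mem_image.1 ha
      rw [dist_comm]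
      exact hidθ b hb y hy
    · obtain ⟨y, hy, rfl⟩ := Finset.mem_image.1 ha
      obtain ⟨z, hz, rfl⟩ := Finset.mem_image.1 hb
      exact hθθ y hy z hz
  · intro a ha
    rcases Finset.mem_union.1 ha with ha | ha
    · exact hv a ha
    · obtain ⟨y, hy, rfl⟩ := Finset.mem_image.1 ha
      exact (hvX y hy).mono hXY le_rfl

end DataHomotopy
end
end

section
/- Let X ⊆ Y be finite subsets of ℝ^n, let r > 0 and k ≥ 1 an integer. If X^{k+1}_dis is r-dense in Y^{k+1}_dis and Y^{k+1}_dis is nonempty, then X^k_dis is r-dense in Y^k_dis. -/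
open scoped Classical

noncomputable section

namespace DataHomotopy

theorem stmt4 {n : ℕ} (X Y : Finset (Pt n)) (hXY : X ⊆ Y) (r : ℝ) (hr : 0 < r)
    (k : ℕ) (hk : 1 ≤ k) (hdense : ConfigDense X Y (k + 1) r)
    (hne : ∃ y : Fin (k + 1) → Pt n, (∀ i, y i ∈ Y) ∧ Function.Injective y) :
    ConfigDense X Y k r := by
  intro y hyY hy
  obtain ⟨w, hwY, hw⟩ := hne
  obtain ⟨a, haY, hay⟩ : ∃ a ∈ Y, a ∉ Set.range y := by
    by_contra! h
    have hsub : Finset.univ.image w ⊆ Finset.univ.image y := by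
      intro b hb
      obtain ⟨i, -, rfl⟩ := Finset.mem_image.1 hb
      obtain ⟨j, hj⟩ := h _ (hwY i)
      exact Finset.mem_image.2 ⟨j, Finset.mem_univ j, hj⟩
    have hcard := Finset.card_le_card hsub
    rw [Finset.card_image_of_injective _ hw, Finset.card_image_of_injective _ hy] at hcard
    simp at hcard
  obtain ⟨x, hxX, hx, hxr⟩ := hdense (Fin.cons a y)
    (Fin.cases haY hyY) (Fin.cons_injective_iff.2 ⟨hay, hy⟩)
  refine ⟨fun i => x i.succ, fun i => hxX _, hx.comp (Fin.succ_injective k), ?_⟩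
  refine lt_of_le_of_lt (Real.sqrt_le_sqrt ?_) hxr
  rw [Fin.sum_univ_succ]
  simp

end DataHomotopy
end
end

section
/- Let X ⊆ Y be finite subsets of ℝ^n, let r > 0 and k ≥ 0 an integer. If X^{k+1}_dis is r-dense in Y^{k+1}_dis and Y^{k+1}_dis is nonempty, then for every integer m with 1 ≤ m ≤ k+1, X^m_dis is r-dense in Y^m_dis. -/
open scoped Classical

noncomputable section

namespace DataHomotopy

theorem ConfigDense.of_succ {n : ℕ} {X Y : Finset (Pt n)} {m : ℕ} {r : ℝ}
    (hm : m < Y.card) (h : ConfigDense X Y (m + 1) r) : ConfigDense X Y m r := by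
  intro y hyY hy
  obtain ⟨z, hzY, hz⟩ : ∃ z ∈ Y, z ∉ Finset.univ.image y := by
    refine Finset.exists_mem_notMem_of_card_lt_card ?_
    simpa [Finset.card_image_of_injective _ hy] using hm
  obtain ⟨x, hxX, hx, hd⟩ := h (Fin.cons z y) (Fin.cases hzY hyY)
    (Fin.cons_injective_iff.2 ⟨by simpa using hz, hy⟩)
  refine ⟨fun i => x i.succ, fun i => hxX _, hx.comp (Fin.succ_injective m), lt_of_le_of_lt ?_ hd⟩
  refine Real.sqrt_le_sqrt ?_
  rw [Fin.sum_univ_succ]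
  simp only [Fin.cons_succ]
  exact le_add_of_nonneg_left (sq_nonneg _)

theorem stmt5 {n : ℕ} (X Y : Finset (Pt n)) (hXY : X ⊆ Y) (r : ℝ) (hr : 0 < r)
    (k : ℕ) (hdense : ConfigDense X Y (k + 1) r)
    (hne : ∃ y : Fin (k + 1) → Pt n, (∀ i, y i ∈ Y) ∧ Function.Injective y) :
    ∀ m : ℕ, 1 ≤ m → m ≤ k + 1 → ConfigDense X Y m r := by
  intro m _ hm
  obtain ⟨y, hyY, hy⟩ := hne
  have hcard : k + 1 ≤ Y.card := by
    simpa using Finset.card_le_card_of_injOn (s := Finset.univ) y (fun i _ => hyY i) hy.injOn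
  induction hm using Nat.decreasingInduction with
  | self => exact hdense
  | of_succ j hj ih => exact ConfigDense.of_succ (hj.trans_le hcard) (ih (Nat.succ_pos j))

end DataHomotopy
end
end

section
/- Let X be a finite subset of ℝ^n and k ≥ 0 an integer. If (t, x) is a branch point of Γ_k(X), then t = d(a, b) for some a, b ∈ X (possibly a = b, so t = 0 is allowed); that is, every branch point occurs at a phase-change number of X. -/
open scoped Classical

noncomputable section

namespace DataHomotopy

theorem IsLVertex.of_dist {n : ℕ} {X : Finset (Pt n)} {k : ℕ} {s t : ℝ} {x : Pt n}
    (h : ∀ a ∈ X, ∀ b ∈ X, dist a b ≤ t → dist a b ≤ s) (hx : IsLVertex X k t x) :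
    IsLVertex X k s x := by
  obtain ⟨hxX, S, hSX, hxS, hk, hS⟩ := hx
  exact ⟨hxX, S, hSX, hxS, hk, fun y hy => h x hxX y (hSX hy) (hS y hy)⟩

theorem SameComp.right {n : ℕ} {X : Finset (Pt n)} {k : ℕ} {s : ℝ} {x y : Pt n}
    (h : SameComp X k s x y) : IsLVertex X k s y := by
  obtain ⟨hx, hc⟩ := h
  cases hc with
  | refl => exact hx
  | tail _ hbc => exact hbc.1

theorem SameComp.of_dist {n : ℕ} {X : Finset (Pt n)} {k : ℕ} {s t : ℝ} {x y : Pt n}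
    (h : ∀ a ∈ X, ∀ b ∈ X, dist a b ≤ t → dist a b ≤ s) (hxy : SameComp X k t x y) :
    SameComp X k s x y := by
  obtain ⟨hx, hc⟩ := hxy
  refine ⟨hx.of_dist h, ?_⟩
  induction hc with
  | refl => exact .refl
  | tail hab hbc ih =>
    have hb := SameComp.right ⟨hx, hab⟩
    exact ih.tail ⟨hbc.1.of_dist h, h _ hb.1 _ hbc.1.1 hbc.2⟩

theorem SameComp.trans {n : ℕ} {X : Finset (Pt n)} {k : ℕ} {s : ℝ} {x y z : Pt n}
    (hxy : SameComp X k s x y) (hyz : SameComp X k s y z) : SameComp X k s x z :=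
  ⟨hxy.1, hxy.2.trans hyz.2⟩

theorem SameComp.symm {n : ℕ} {X : Finset (Pt n)} {k : ℕ} {s : ℝ} {x y : Pt n}
    (hxy : SameComp X k s x y) : SameComp X k s y x := by
  obtain ⟨hx, hc⟩ := hxy
  induction hc with
  | refl => exact ⟨hx, .refl⟩
  | tail hab hbc ih =>
    have hb := SameComp.right ⟨hx, hab⟩
    exact SameComp.trans ⟨hbc.1, .single ⟨hb, by simpa [dist_comm] using hbc.2⟩⟩ ih

/-- If `t` is not a distance between points of `X`, then some `s < t` above any given bound
has no distance of `X` in `(s, t]`. -/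
theorem exists_lt_forall_dist_le {n : ℕ} (X : Finset (Pt n)) {c t : ℝ} (hc : c < t)
    (ht : ∀ a ∈ X, ∀ b ∈ X, t ≠ dist a b) :
    ∃ s, c ≤ s ∧ s < t ∧ ∀ a ∈ X, ∀ b ∈ X, dist a b ≤ t → dist a b ≤ s := by
  have hev : ∀ᶠ s in nhdsWithin t (Set.Iio t),
      ∀ a ∈ X, ∀ b ∈ X, dist a b ≤ t → dist a b ≤ s := by
    simp only [Finset.eventually_all]
    intro a ha b hb
    by_cases hab : dist a b ≤ t
    · filter_upwards [Ioo_mem_nhdsLT (lt_of_le_of_ne hab (ht a ha b hb).symm)] with s hs _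
      exact hs.1.le
    · exact .of_forall fun _ h => absurd h hab
  obtain ⟨s, hs, hcs⟩ := (hev.and (Ioo_mem_nhdsLT hc)).exists
  exact ⟨s, hcs.1.le, hcs.2, hs⟩

theorem stmt14 {n : ℕ} (X : Finset (Pt n)) (k : ℕ) (t : ℝ) (x : Pt n)
    (hbr : IsBranch X k (t, x)) :
    ∃ a ∈ X, ∃ b ∈ X, t = dist a b := by
  by_contra! hne
  obtain ⟨⟨ht, hx⟩, hbr⟩ := hbr
  have ht0 : 0 < t := lt_of_le_of_ne ht fun h => hne x hx.1 x hx.1 (by simp [← h])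
  rcases hbr with ⟨s₀, hs₀, h⟩ | h
  · obtain ⟨s, hs, hst, hd⟩ := exists_lt_forall_dist_le X hs₀ hne
    obtain ⟨x₀, x₁, -, -, hcomp, h₀, h₁⟩ := h s hs hst
    exact hcomp ((h₀.2.of_dist hd).trans (h₁.2.of_dist hd).symm)
  · obtain ⟨s, hs, hst, hd⟩ := exists_lt_forall_dist_le X ht0 hne
    exact h ⟨(s, x), hst, ⟨hs, hx.of_dist hd⟩, hst.le, hx, .refl⟩


end DataHomotopy
end
end

section
/- Let X ⊆ Y be finite subsets of ℝ^n, r > 0, and k ≥ 0 an integer with |Y| ≥ k+1, and suppose X^{k+1}_dis is r-dense in Y^{k+1}_dis. Then there exists a function θ : Y → X such that d(y, θ(y)) < r for all y ∈ Y, for every t ≥ 0, if y is a vertex of L_{t,k}(Y) then θ(y) is a vertex of L_{t+2r,k}(X), and the map Γ_k(Y) → Γ_k(X) sending (t, y) to (t + 2r, θ(y)) is order-preserving. -/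
open scoped Classical

noncomputable section

namespace DataHomotopy

/-- Configuration density yields an injective `r`-displacement of any `m`-point subset of `Y`
into `X`. -/
theorem ConfigDense.exists_injOn {n m : ℕ} {X Y : Finset (Pt n)} {r : ℝ}
    (h : ConfigDense X Y m r) {T : Finset (Pt n)} (hT : T ⊆ Y) (hcard : T.card = m) :
    ∃ f : Pt n → Pt n, Set.InjOn f T ∧ ∀ a ∈ T, f a ∈ X ∧ dist a (f a) < r := by
  let e := T.equivFinOfCardEq hcard
  obtain ⟨x, hxX, hx, hd⟩ := h (fun i => (e.symm i : Pt n)) (fun i => hT (e.symm i).2)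
    (Subtype.val_injective.comp e.symm.injective)
  refine ⟨fun a => if ha : a ∈ T then x (e ⟨a, ha⟩) else a, ?_, ?_⟩
  · intro a ha b hb hab
    simp only [Finset.mem_coe] at ha hb
    simp only [ha, hb, dite_true] at hab
    exact congrArg Subtype.val (e.injective (hx hab))
  · intro a ha
    simp only [ha, dite_true]
    refine ⟨hxX _, ?_⟩
    simpa using (dist_le_tupleDist _ x (e ⟨a, ha⟩)).trans_lt hd

/-- Every point of `Y` lies within `r` of a point of `X`. -/
theorem ConfigDense.exists_dist_lt {n k : ℕ} {X Y : Finset (Pt n)} {r : ℝ}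
    (h : ConfigDense X Y (k + 1) r) (hcard : k + 1 ≤ Y.card) {y : Pt n} (hy : y ∈ Y) :
    ∃ x ∈ X, dist y x < r := by
  obtain ⟨T, hyT, hTY, hT⟩ := Finset.exists_subsuperset_card_eq
    (Finset.singleton_subset_iff.2 hy) (by simp) hcard
  obtain ⟨f, -, hf⟩ := h.exists_injOn hTY hT
  exact ⟨f y, hf y (Finset.singleton_subset_iff.1 hyT)⟩

/-- A point of `X` within `r` of a vertex of `L_{t,k}(Y)` is a vertex of `L_{t+2r,k}(X)`. -/
theorem ConfigDense.isLVertex {n k : ℕ} {X Y : Finset (Pt n)} {r t : ℝ}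
    (h : ConfigDense X Y (k + 1) r) (ht : 0 ≤ t) {x y : Pt n} (hx : x ∈ X)
    (hd : dist y x < r) (hy : IsLVertex Y k t y) : IsLVertex X k (t + 2 * r) x := by
  obtain ⟨hyY, S, hSY, hyS, hkS, hS⟩ := hy
  obtain ⟨S', hS'S, hS'⟩ := Finset.exists_subset_card_eq hkS
  obtain ⟨f, hinj, hf⟩ := h.exists_injOn (T := insert y S')
    (Finset.insert_subset hyY (hS'S.trans hSY))
    (by rw [Finset.card_insert_of_notMem fun hy => hyS (hS'S hy), hS'])
  refine ⟨hx, ((insert y S').image f).erase x, ?_, Finset.notMem_erase _ _, ?_, ?_⟩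
  · refine (Finset.erase_subset _ _).trans (Finset.image_subset_iff.2 fun a ha => (hf a ha).1)
  · have hc : ((insert y S').image f).card = k + 1 := by
      rw [Finset.card_image_of_injOn hinj,
        Finset.card_insert_of_notMem fun hy => hyS (hS'S hy), hS']
    have := Finset.pred_card_le_card_erase (s := (insert y S').image f) (a := x)
    omega
  · intro x' hx'
    obtain ⟨a, ha, rfl⟩ := Finset.mem_image.1 (Finset.mem_of_mem_erase hx')
    have hya : dist y a ≤ t := by
      rcases Finset.mem_insert.1 ha with rfl | ha
      · simpa using ht
      · exact hS a (hS'S ha)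
    have := dist_triangle4 x y a (f a)
    linarith [(hf a ha).2, dist_comm x y]

theorem stmt17 {n : ℕ} (X Y : Finset (Pt n)) (hXY : X ⊆ Y) (r : ℝ) (hr : 0 < r)
    (k : ℕ) (hcard : k + 1 ≤ Y.card) (hdense : ConfigDense X Y (k + 1) r) :
    ∃ θ : Pt n → Pt n,
      (∀ y ∈ Y, θ y ∈ X ∧ dist y (θ y) < r) ∧
      (∀ t : ℝ, 0 ≤ t → ∀ y : Pt n, IsLVertex Y k t y →
        IsLVertex X k (t + 2 * r) (θ y)) ∧
      (∀ p q : ℝ × Pt n, InGamma Y k p → InGamma Y k q → GammaLe Y k p q →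
        GammaLe X k (p.1 + 2 * r, θ p.2) (q.1 + 2 * r, θ q.2)) := by
  choose! θ hθX hθ using fun y (hy : y ∈ Y) => hdense.exists_dist_lt hcard hy
  have hvert : ∀ t : ℝ, 0 ≤ t → ∀ y : Pt n, IsLVertex Y k t y →
      IsLVertex X k (t + 2 * r) (θ y) := fun t ht y hy =>
    hdense.isLVertex ht (hθX y hy.1) (hθ y hy.1) hy
  refine ⟨θ, fun y hy => ⟨hθX y hy, hθ y hy⟩, hvert, ?_⟩
  rintro ⟨s, x⟩ ⟨t, y⟩ - ⟨ht, -⟩ ⟨hst, hx, hchain⟩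
  dsimp only at ht hst hx hchain
  refine ⟨by simpa using hst, hvert t ht x hx, ?_⟩
  have hlift : IsLVertex Y k t y ∧ Relation.ReflTransGen
      (fun a b => IsLVertex X k (t + 2 * r) b ∧ dist a b ≤ t + 2 * r) (θ x) (θ y) := by
    induction hchain with
    | refl => exact ⟨hx, .refl⟩
    | @tail a b _ hab ih =>
      refine ⟨hab.1, ih.2.tail ⟨hvert t ht b hab.1, ?_⟩⟩
      have := dist_triangle4 (θ a) a b (θ b)
      linarith [hab.2, hθ a ih.1.1, hθ b hab.1.1, dist_comm (θ a) a]
  exact hlift.2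

end DataHomotopy
end
end
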